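/- There do not exist real polynomials P and Q such that Q(x) ≠ 0 for all x ∈ (−1, 0] and the two-sided bound ln(1+x) ≥ P(x)/Q(x) ≥ f(x)/√(x+1) holds for all real x ∈ (−1, 0]. -/

import Mathlib

open Real Set

noncomputable def f (x : ℝ) : ℝ :=
  π + (1 / 2) * (4 + π) * x - 2 * (x + 2) * Real.arctan (Real.sqrt (x + 1))

open Filter Topology

/-- A nonzero polynomial is a power of `X - a` times a polynomial not vanishing at `a`. -/
lemma Polynomial.exists_eval_eq_pow_mul {P : Polynomial ℝ} (hP : P ≠ 0) (a : ℝ) :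
    ∃ (m : ℕ) (P₁ : Polynomial ℝ), P₁.eval a ≠ 0 ∧ ∀ x, P.eval x = (x - a) ^ m * P₁.eval x := by
  obtain ⟨P₁, h, hd⟩ := Polynomial.exists_eq_pow_rootMultiplicity_mul_and_not_dvd P hP a
  refine ⟨P.rootMultiplicity a, P₁, fun h0 => hd (Polynomial.dvd_iff_isRoot.2 h0), fun x => ?_⟩
  conv_lhs => rw [h]
  simp

/-- A quotient of polynomials that tends to `-∞` at `a` from the right has a pole there, so its
product with `x - a` does not tend to zero. -/
lemma Polynomial.not_tendsto_sub_mul_div_zero {P Q : Polynomial ℝ} {a : ℝ} (hP : P ≠ 0)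
    (hQ : Q ≠ 0) (hbot : Tendsto (fun x => P.eval x / Q.eval x) (𝓝[>] a) atBot) :
    ¬ Tendsto (fun x => (x - a) * (P.eval x / Q.eval x)) (𝓝[>] a) (𝓝 0) := by
  intro hzero
  obtain ⟨m, P₁, hP₁, hPm⟩ := Polynomial.exists_eval_eq_pow_mul hP a
  obtain ⟨n, Q₁, hQ₁, hQn⟩ := Polynomial.exists_eval_eq_pow_mul hQ a
  have hg : Tendsto (fun x => P₁.eval x / Q₁.eval x) (𝓝[>] a) (𝓝 (P₁.eval a / Q₁.eval a)) :=
    (P₁.continuous.continuousAt.div Q₁.continuous.continuousAt hQ₁).tendsto.mono_left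
      nhdsWithin_le_nhds
  have hpow (k : ℕ) : Tendsto (fun x : ℝ => (x - a) ^ k) (𝓝[>] a) (𝓝 ((a - a) ^ k)) :=
    (Continuous.tendsto (by fun_prop) a).mono_left nhdsWithin_le_nhds
  rcases le_or_gt n m with h | h
  · obtain ⟨k, rfl⟩ := Nat.exists_eq_add_of_le h
    refine not_tendsto_nhds_of_tendsto_atBot hbot _ (((hpow k).mul hg).congr' ?_)
    filter_upwards [self_mem_nhdsWithin] with x hx
    have hx : x - a ≠ 0 := sub_ne_zero.2 (ne_of_gt hx)
    rw [hPm, hQn, pow_add, mul_assoc, mul_div_mul_left _ _ (pow_ne_zero _ hx), mul_div_assoc]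
  · obtain ⟨k, rfl⟩ := Nat.exists_eq_add_of_lt h
    have hlim : Tendsto (fun x => P₁.eval x / Q₁.eval x) (𝓝[>] a) (𝓝 0) := by
      have h0 := (hpow k).mul hzero
      rw [mul_zero] at h0
      refine h0.congr' ?_
      filter_upwards [self_mem_nhdsWithin] with x hx
      have hx : x - a ≠ 0 := sub_ne_zero.2 (ne_of_gt hx)
      have hk : (x - a) ^ (m + k + 1) = (x - a) ^ m * ((x - a) ^ k * (x - a)) := by ring
      rw [hPm, hQn, hk, mul_assoc, mul_div_mul_left _ _ (pow_ne_zero _ hx), ← mul_assoc,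
        ← mul_div_assoc, mul_div_mul_left _ _ (mul_ne_zero (pow_ne_zero _ hx) hx)]
    exact div_ne_zero hP₁ hQ₁ (tendsto_nhds_unique hg hlim)

theorem no_rational_intermediate_below :
    ¬ ∃ P Q : Polynomial ℝ,
      (∀ x : ℝ, x ∈ Set.Ioc (-1 : ℝ) 0 → Q.eval x ≠ 0) ∧
      (∀ x : ℝ, x ∈ Set.Ioc (-1 : ℝ) 0 →
        Real.log (1 + x) ≥ P.eval x / Q.eval x ∧
        P.eval x / Q.eval x ≥ f x / Real.sqrt (x + 1)) := by
  rintro ⟨P, Q, hQ, h⟩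
  have hP0 : P ≠ 0 := by
    rintro rfl
    have h1 := (h (-1 / 2) (by norm_num)).1
    have h2 : Real.log (1 + -1 / 2) < 0 := Real.log_neg (by norm_num) (by norm_num)
    simp only [Polynomial.eval_zero, zero_div] at h1
    linarith
  have hQ0 : Q ≠ 0 := by
    rintro rfl
    exact hQ 0 (by norm_num) (by simp)
  have hmem : ∀ᶠ x in 𝓝[>] (-1 : ℝ), x ∈ Set.Ioc (-1 : ℝ) 0 :=
    Ioc_mem_nhdsGT (by norm_num)
  have hshift : Tendsto (fun x : ℝ => 1 + x) (𝓝[>] (-1)) (𝓝[>] 0) := by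
    refine tendsto_nhdsWithin_iff.2 ⟨?_, ?_⟩
    · exact (Continuous.tendsto' (by fun_prop) _ _ (by norm_num)).mono_left nhdsWithin_le_nhds
    · filter_upwards [self_mem_nhdsWithin] with x hx
      have : -1 < x := hx
      change 0 < 1 + x
      linarith
  have hbot : Tendsto (fun x => P.eval x / Q.eval x) (𝓝[>] (-1)) atBot :=
    tendsto_atBot_mono' _ (hmem.mono fun x hx => (h x hx).1)
      (Real.tendsto_log_nhdsGT_zero.comp hshift)
  refine Polynomial.not_tendsto_sub_mul_div_zero hP0 hQ0 hbot ?_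
  have hupper : Tendsto (fun x : ℝ => (1 + x) * Real.log (1 + x)) (𝓝[>] (-1)) (𝓝 0) :=
    (Continuous.tendsto' (Real.continuous_mul_log.comp (continuous_const.add continuous_id))
      _ _ (by norm_num)).mono_left nhdsWithin_le_nhds
  have hlower : Tendsto (fun x : ℝ => √(x + 1) * f x) (𝓝[>] (-1)) (𝓝 0) := by
    refine (Continuous.tendsto' ?_ _ _ (by norm_num)).mono_left nhdsWithin_le_nhds
    unfold f
    fun_prop
  refine tendsto_of_tendsto_of_tendsto_of_le_of_le' hlower hupper ?_ ?_
  · filter_upwards [hmem] with x hx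
    have hx1 : 0 < x + 1 := by linarith [hx.1]
    calc √(x + 1) * f x = (x - -1) * (f x / √(x + 1)) := by
          rw [sub_neg_eq_add, mul_div_left_comm, Real.div_sqrt, mul_comm]
      _ ≤ _ := mul_le_mul_of_nonneg_left (h x hx).2 (by linarith)
  · filter_upwards [hmem] with x hx
    rw [sub_neg_eq_add, add_comm x 1]
    exact mul_le_mul_of_nonneg_left (h x hx).1 (by linarith [hx.1])
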